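/- Let g ≥ 1 and 1 ≤ h ≤ ⌊g/2⌋. The sequence ((2g+1, …, 1) repeated 2(h+1) times) ⧺ ((1, …, 2g+1) repeated 2(h+1) times) can be transformed by finitely many H1- and H2-moves and their inverses into the sequence (2g+1, …, 1) ⧺ (2g−2h+1, …, 2g+1) ⧺ (2g−2h, …, 2g) ⧺ ⋯ ⧺ (1, …, 2h+1) ⧺ ((2h, …, 1) repeated 2h+1 times) ⧺ ((1, …, 2h) repeated 2h+1 times) ⧺ (2h+1, …, 1) ⧺ (2h+2, …, 2) ⧺ ⋯ ⧺ (2g+1, …, 2g−2h+1) ⧺ (1, …, 2g+1). -/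

import Mathlib

/-- Concatenation of k copies of a list. -/
def repL {α : Type*} (k : ℕ) (w : List α) : List α := (List.replicate k w).flatten

/-- H1- and H2-moves on sequences with entries in {1, …, N}. -/
inductive BStep (N : ℕ) : List ℕ → List ℕ → Prop
  | h1 (l₁ l₂ : List ℕ) (i j : ℕ) : 1 ≤ i → i ≤ N → 1 ≤ j → j ≤ N →
      (i+2 ≤ j ∨ j+2 ≤ i) →
      BStep N (l₁ ++ [i, j] ++ l₂) (l₁ ++ [j, i] ++ l₂)
  | h2 (l₁ l₂ : List ℕ) (i j : ℕ) : 1 ≤ i → i ≤ N → 1 ≤ j → j ≤ N →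
      (i+1 = j ∨ j+1 = i) →
      BStep N (l₁ ++ [i, j, i] ++ l₂) (l₁ ++ [j, i, j] ++ l₂)

/-- Ascending blocks (2g−2h+1,…,2g+1), (2g−2h,…,2g), …, (1,…,2h+1). -/
def ascBlocks (g h : ℕ) : List ℕ :=
  ((List.range (2*g-2*h+1)).map fun k => List.range' (2*g-2*h+1-k) (2*h+1)).flatten

/-- Descending blocks (2h+1,…,1), (2h+2,…,2), …, (2g+1,…,2g−2h+1). -/
def descBlocks (g h : ℕ) : List ℕ :=
  ((List.range (2*g-2*h+1)).map fun k => (List.range' (k+1) (2*h+1)).reverse).flatten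

/-- Equivalence under moves. -/
def BrEq (N : ℕ) (a b : List ℕ) : Prop := Relation.EqvGen (BStep N) a b

theorem BrEq.rfl' {N : ℕ} (a : List ℕ) : BrEq N a a := Relation.EqvGen.refl a

theorem BrEq.tr {N : ℕ} {a b c : List ℕ} (h : BrEq N a b) (h' : BrEq N b c) : BrEq N a c :=
  Relation.EqvGen.trans _ _ _ h h'

theorem BrEq.ctx {N : ℕ} {a b : List ℕ} (h : BrEq N a b) (l r : List ℕ) :
    BrEq N (l ++ a ++ r) (l ++ b ++ r) := by
  induction h with
  | rel x y h =>
    apply Relation.EqvGen.rel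
    cases h with
    | h1 l₁ l₂ i j a1 a2 a3 a4 a5 =>
      have := BStep.h1 (N := N) (l ++ l₁) (l₂ ++ r) i j a1 a2 a3 a4 a5
      simpa [List.append_assoc] using this
    | h2 l₁ l₂ i j a1 a2 a3 a4 a5 =>
      have := BStep.h2 (N := N) (l ++ l₁) (l₂ ++ r) i j a1 a2 a3 a4 a5
      simpa [List.append_assoc] using this
  | refl x => exact Relation.EqvGen.refl _
  | symm x y _ ih => exact Relation.EqvGen.symm _ _ ih
  | trans x y z _ _ i1 i2 => exact Relation.EqvGen.trans _ _ _ i1 i2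

theorem BrEq.app {N : ℕ} {a b c d : List ℕ} (h : BrEq N a b) (h' : BrEq N c d) :
    BrEq N (a ++ c) (b ++ d) := by
  have h1 := h.ctx [] c
  have h2 := h'.ctx b []
  simp only [List.nil_append, List.append_nil] at h1 h2
  exact h1.tr h2

theorem BrEq.rev {N : ℕ} {a b : List ℕ} (h : BrEq N a b) : BrEq N a.reverse b.reverse := by
  induction h with
  | rel x y h =>
    cases h with
    | h1 l₁ l₂ i j a1 a2 a3 a4 a5 =>
      apply Relation.EqvGen.rel
      have := BStep.h1 (N := N) l₂.reverse l₁.reverse j i a3 a4 a1 a2 a5.symm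
      simpa [List.append_assoc] using this
    | h2 l₁ l₂ i j a1 a2 a3 a4 a5 =>
      apply Relation.EqvGen.rel
      have := BStep.h2 (N := N) l₂.reverse l₁.reverse i j a1 a2 a3 a4 a5
      simpa [List.append_assoc] using this
  | refl x => exact Relation.EqvGen.refl _
  | symm x y _ ih => exact Relation.EqvGen.symm _ _ ih
  | trans x y z _ _ i1 i2 => exact Relation.EqvGen.trans _ _ _ i1 i2

/-- The descending run m, …, 1. -/
def Dn (m : ℕ) : List ℕ := (List.range' 1 m).reverse

theorem Dn_succ (m : ℕ) : Dn (m+1) = [m+1] ++ Dn m := by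
  simp [Dn, List.range'_concat, Nat.add_comm]

theorem repL_succ {α : Type*} (k : ℕ) (w : List α) : repL (k+1) w = w ++ repL k w := by
  simp [repL, List.replicate_succ]

theorem repL_succ' {α : Type*} (k : ℕ) (w : List α) : repL (k+1) w = repL k w ++ w := by
  simp [repL, List.replicate_succ']

theorem repL_reverse {α : Type*} (k : ℕ) (w : List α) :
    (repL k w).reverse = repL k w.reverse := by
  induction k with
  | zero => simp [repL]
  | succ k ih => rw [repL_succ, List.reverse_append, ih, repL_succ']

theorem swap_far {N i j : ℕ} (a1 : 1 ≤ i) (a2 : i ≤ N) (a3 : 1 ≤ j) (a4 : j ≤ N)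
    (a5 : i+2 ≤ j ∨ j+2 ≤ i) : BrEq N ([i] ++ [j]) ([j] ++ [i]) := by
  have := BStep.h1 (N := N) [] [] i j a1 a2 a3 a4 a5
  exact Relation.EqvGen.rel _ _ (by simpa using this)

theorem Dn_far {N : ℕ} (p j : ℕ) (h : p + 2 ≤ j) (hj : j ≤ N) :
    BrEq N (Dn p ++ [j]) ([j] ++ Dn p) := by
  induction p with
  | zero => exact BrEq.rfl' _
  | succ p ih =>
    rw [Dn_succ]
    have e1 := (BrEq.rfl' (N := N) [p+1]).app (ih (by omega))
    have e2 := (swap_far (N := N) (i := p+1) (j := j) (by omega) (by omega) (by omega) hj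
      (by omega)).app (BrEq.rfl' (Dn p))
    simp only [List.append_assoc] at e1 e2 ⊢
    exact e1.tr e2

theorem Dn_shift {N : ℕ} (m i : ℕ) (hi : 1 ≤ i) (him : i + 1 ≤ m) (hm : m ≤ N) :
    BrEq N (Dn m ++ [i+1]) ([i] ++ Dn m) := by
  induction m with
  | zero => omega
  | succ m ih =>
    rcases Nat.lt_or_ge i m with h | h
    · rw [Dn_succ]
      have e1 := (BrEq.rfl' (N := N) [m+1]).app (ih (by omega) (by omega))
      have e2 := (swap_far (N := N) (i := m+1) (j := i) (by omega) (by omega) (by omega)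
        (by omega) (by omega)).app (BrEq.rfl' (Dn m))
      simp only [List.append_assoc] at e1 e2 ⊢
      exact e1.tr e2
    · obtain rfl : i = m := by omega
      obtain ⟨p, rfl⟩ : ∃ p, i = p + 1 := ⟨i - 1, by omega⟩
      rw [Dn_succ, Dn_succ]
      have e1 := (BrEq.rfl' (N := N) ([p+1+1] ++ [p+1])).app
        (Dn_far (N := N) p (p+1+1) (by omega) hm)
      have s := BStep.h2 (N := N) [] (Dn p) (p+1+1) (p+1) (by omega) hm (by omega) (by omega)
        (by omega)
      have e2 : BrEq N _ _ := Relation.EqvGen.rel _ _ s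
      simp only [List.append_assoc, List.nil_append, List.cons_append] at e1 e2 ⊢
      exact e1.tr e2

theorem Dn_shift_pow {N : ℕ} (m k i : ℕ) (hi : 1 ≤ i) (him : i + k ≤ m) (hm : m ≤ N) :
    BrEq N (repL k (Dn m) ++ [i+k]) ([i] ++ repL k (Dn m)) := by
  induction k with
  | zero => exact BrEq.rfl' _
  | succ k ih =>
    have e1 := (BrEq.rfl' (N := N) (repL k (Dn m))).app
      (Dn_shift (N := N) m (i+k) (by omega) (by omega) hm)
    have e2 := (ih (by omega)).app (BrEq.rfl' (Dn m))
    rw [repL_succ']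
    simp only [List.append_assoc] at e1 e2 ⊢
    exact e1.tr e2

theorem Dn_pow_step {N : ℕ} (n k : ℕ) (hk : k ≤ n + 1) (hn : n + 1 ≤ N) :
    BrEq N (repL k (Dn (n+1))) (List.range' (n+2-k) k ++ repL k (Dn n)) := by
  induction k with
  | zero => exact BrEq.rfl' _
  | succ k ih =>
    have e1 := (Dn_shift_pow (N := N) (n+1) k (n+1-k) (by omega) (by omega) hn).app
      (BrEq.rfl' (Dn n))
    have e2 := (BrEq.rfl' (N := N) [n+1-k]).app ((ih (by omega)).app (BrEq.rfl' (Dn n)))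
    have hs : n + 1 - k + k = n + 1 := by omega
    have h2 : n + 2 - (k+1) = n + 1 - k := by omega
    have h3 : n + 2 - k = n + 1 - k + 1 := by omega
    rw [hs] at e1
    rw [h3] at e2
    have e : repL (k+1) (Dn (n+1)) = repL k (Dn (n+1)) ++ ([n+1] ++ Dn n) := by
      rw [repL_succ', ← Dn_succ]
    rw [e, repL_succ' k (Dn n), h2, List.range'_succ]
    simp only [List.append_assoc, List.cons_append, List.nil_append] at e1 e2 ⊢
    exact e1.tr e2

/-- Ascending blocks of length k. -/
def Bl (k m : ℕ) : List ℕ := ((List.range m).map fun t => List.range' (m-t) k).flatten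

theorem Bl_succ (k m : ℕ) : Bl k (m+1) = List.range' (m+1) k ++ Bl k m := by
  simp [Bl, List.range_succ_eq_map, Function.comp_def]

theorem Dn_pow {N : ℕ} (k m : ℕ) (h : k + m ≤ N) :
    BrEq N (repL (k+1) (Dn (k+m))) (Bl (k+1) m ++ repL (k+1) (Dn k)) := by
  induction m with
  | zero => exact BrEq.rfl' _
  | succ m ih =>
    have e1 := Dn_pow_step (N := N) (k+m) (k+1) (by omega) (by omega)
    have e2 := (BrEq.rfl' (N := N) (List.range' (m+1) (k+1))).app (ih (by omega))
    have h3 : k + m + 2 - (k+1) = m + 1 := by omega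
    rw [h3] at e1
    rw [Bl_succ, List.append_assoc]
    exact e1.tr e2

theorem Bl_reverse (k m : ℕ) : (Bl k m).reverse =
    ((List.range m).map fun t => (List.range' (t+1) k).reverse).flatten := by
  induction m with
  | zero => rfl
  | succ m ih => rw [Bl_succ, List.reverse_append, ih]; simp [List.range_succ]

theorem statement7 (g h : ℕ) (hg : 1 ≤ g) (hh1 : 1 ≤ h) (hh2 : h ≤ g/2) :
    Relation.EqvGen (BStep (2*g+1))
      (repL (2*(h+1)) ((List.range' 1 (2*g+1)).reverse) ++
        repL (2*(h+1)) (List.range' 1 (2*g+1)))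
      ((List.range' 1 (2*g+1)).reverse ++ ascBlocks g h ++
        repL (2*h+1) ((List.range' 1 (2*h)).reverse) ++
        repL (2*h+1) (List.range' 1 (2*h)) ++
        descBlocks g h ++ List.range' 1 (2*g+1)) := by
  have key := Dn_pow (N := 2*g+1) (2*h) (2*g-2*h+1) (by omega)
  have hs : 2*h + (2*g-2*h+1) = 2*g+1 := by omega
  rw [hs] at key
  have keyr := key.rev
  rw [List.reverse_append, repL_reverse, repL_reverse, Bl_reverse] at keyr
  simp only [Dn, List.reverse_reverse] at key keyr
  have fin := ((BrEq.rfl' (N := 2*g+1) (List.range' 1 (2*g+1)).reverse).app key).app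
    (keyr.app (BrEq.rfl' (List.range' 1 (2*g+1))))
  have h2 : 2*(h+1) = 2*h+1+1 := by ring
  rw [h2, repL_succ, repL_succ' _ (List.range' 1 (2*g+1))]
  simp only [List.append_assoc] at fin ⊢
  exact fin
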